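/- arXiv:1906.09056 — 2 statements merged into one kernel-verified Lean document; each statement's English description precedes it below -/
import Mathlib

section
/- Let G be a simple graph on n ≥ 2 vertices with at least one edge and with largest degree d₁. Then the largest Laplacian eigenvalue of G satisfies μ₁(G) ≥ 1 + d₁. -/
open Finset

/-- The eigenvalues of the Laplacian matrix of `G`, arranged in non-increasing order:
`lapEigs G 0 = μ₁ ≥ lapEigs G 1 = μ₂ ≥ …`. -/
noncomputable def lapEigs {n : ℕ} (G : SimpleGraph (Fin n)) : Fin n → ℝ := by
  letI := Classical.decRel G.Adj
  letI := fun (a b : Fin n) => Classical.dec (a = b)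
  exact fun i =>
    ((G.posSemidef_lapMatrix ℝ).isHermitian.eigenvalues ∘
      Tuple.sort (G.posSemidef_lapMatrix ℝ).isHermitian.eigenvalues) i.rev

/-- The degree sequence of `G`, arranged in non-increasing order:
`degSeq G 0 = d₁ ≥ degSeq G 1 = d₂ ≥ …`. -/
noncomputable def degSeq {n : ℕ} (G : SimpleGraph (Fin n)) : Fin n → ℕ := by
  letI := Classical.decRel G.Adj
  exact fun i => ((fun v => G.degree v) ∘ Tuple.sort (fun v => G.degree v)) i.rev

/-- The Kirchhoff index `K(G) = n ∑_{i=1}^{n-1} 1/μᵢ`. -/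
noncomputable def kirchhoffIndex {n : ℕ} (G : SimpleGraph (Fin n)) : ℝ :=
  n * ∑ i ∈ Finset.univ.filter (fun i : Fin n => (i : ℕ) < n - 1), 1 / lapEigs G i

/-- `MajorizedBy y x` (`y ⊴ x`) : every partial sum of `y` is at most the corresponding
partial sum of `x`, with equal total sums. -/
def MajorizedBy {n : ℕ} (y x : Fin n → ℝ) : Prop :=
  (∀ k : ℕ, k < n →
      ∑ i ∈ Finset.univ.filter (fun i : Fin n => (i : ℕ) < k), y i ≤
        ∑ i ∈ Finset.univ.filter (fun i : Fin n => (i : ℕ) < k), x i) ∧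
    ∑ i, y i = ∑ i, x i

open Matrix in
/-- If `A` is positive semidefinite with all eigenvalues at most `M`, then `A ^ 2 ≤ M • A`;
this is the diagonal part of that inequality. -/
lemma Matrix.PosSemidef.mul_self_apply_self_le {ι : Type*} [Fintype ι] [DecidableEq ι]
    {A : Matrix ι ι ℝ} (hA : A.PosSemidef) {M : ℝ} (hM : ∀ i, hA.isHermitian.eigenvalues i ≤ M)
    (v : ι) : (A * A) v v ≤ M * A v v := by
  set U : Matrix ι ι ℝ := (hA.isHermitian.eigenvectorUnitary : Matrix ι ι ℝ)
  set ev := hA.isHermitian.eigenvalues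
  have entry (d : ι → ℝ) : (U * diagonal d * star U) v v = ∑ i, d i * U v i ^ 2 := by
    rw [mul_apply]
    refine sum_congr rfl fun i _ => ?_
    rw [mul_diagonal, star_apply, star_trivial]
    ring
  have hspec : A = U * diagonal ev * star U := by
    simpa [Unitary.conjStarAlgAut_apply, Function.comp_def] using hA.isHermitian.spectral_theorem
  have hUU : star U * U = 1 := Unitary.coe_star_mul_self _
  have hsq : A * A = U * diagonal (fun i => ev i * ev i) * star U := by
    rw [← diagonal_mul_diagonal]
    calc A * A = U * diagonal ev * (star U * U) * diagonal ev * star U := by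
          conv_lhs => rw [hspec]
          simp only [Matrix.mul_assoc]
      _ = _ := by rw [hUU, Matrix.mul_one, Matrix.mul_assoc U]
  have hA_vv : A v v = ∑ i, ev i * U v i ^ 2 := by rw [← entry, ← hspec]
  rw [hsq, entry, hA_vv, mul_sum]
  refine sum_le_sum fun i _ => ?_
  rw [← mul_assoc]
  have := hA.eigenvalues_nonneg i
  gcongr
  exact hM i

namespace SimpleGraph

variable {V : Type*} [Fintype V] [DecidableEq V] (G : SimpleGraph V) [DecidableRel G.Adj]

lemma lapMatrix_apply_self (v : V) : G.lapMatrix ℝ v v = G.degree v := by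
  simp [lapMatrix, degMatrix]

lemma lapMatrix_mul_self_apply_self (v : V) :
    (G.lapMatrix ℝ * G.lapMatrix ℝ) v v = G.degree v ^ 2 + G.degree v := by
  have hA := G.adjMatrix_mul_self_apply_self (α := ℝ) v
  rw [lapMatrix, degMatrix, sub_mul, mul_sub, mul_sub]
  simp only [Matrix.sub_apply, Matrix.diagonal_mul, Matrix.mul_diagonal, Matrix.diagonal_apply_eq,
    hA, adjMatrix_apply, G.irrefl, if_false]
  ring

/-- If every Laplacian eigenvalue is at most `M`, then every positive degree is at most `M - 1`. -/
lemma one_add_degree_le_of_eigenvalues_le {M : ℝ}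
    (hM : ∀ i, (G.posSemidef_lapMatrix ℝ).isHermitian.eigenvalues i ≤ M) {v : V}
    (hv : 0 < G.degree v) : 1 + (G.degree v : ℝ) ≤ M := by
  have h := (G.posSemidef_lapMatrix ℝ).mul_self_apply_self_le hM v
  rw [lapMatrix_mul_self_apply_self, lapMatrix_apply_self] at h
  have hv' : (0 : ℝ) < G.degree v := by exact_mod_cast hv
  nlinarith

end SimpleGraph

lemma Tuple.le_comp_sort_rev_zero {n : ℕ} {α : Type*} [LinearOrder α] (f : Fin n → α)
    (hn : 0 < n) (i : Fin n) : f i ≤ (f ∘ Tuple.sort f) (Fin.rev ⟨0, hn⟩) := by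
  have h := Tuple.monotone_sort f (a := (Tuple.sort f).symm i) (b := Fin.rev ⟨0, hn⟩)
    (by rw [Fin.le_def, Fin.val_rev]; simp only; omega)
  simpa using h

/-- For a simple graph `G` on `n ≥ 2` vertices with at least one edge and
largest degree `d₁`, the largest Laplacian eigenvalue satisfies `μ₁(G) ≥ 1 + d₁`. -/
theorem laplacian_largest_eigenvalue_ge {n d₁ : ℕ}
    (hn : 2 ≤ n)
    (G : SimpleGraph (Fin n))
    (hne : G.edgeSet.Nonempty)
    (hd₁ : d₁ = degSeq G ⟨0, by omega⟩) :
    1 + (d₁ : ℝ) ≤ lapEigs G ⟨0, by omega⟩ := by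
  let _ := Classical.decRel G.Adj
  have h0 : 0 < n := by omega
  obtain ⟨v, hv⟩ : ∃ v, degSeq G ⟨0, h0⟩ = G.degree v := ⟨Tuple.sort (fun v => G.degree v) (Fin.rev ⟨0, h0⟩), rfl⟩
  obtain ⟨e, he⟩ := hne
  induction e with | h a b =>
  have ha : 0 < G.degree a := (G.degree_pos_iff_exists_adj a).2 ⟨b, he⟩
  have hav : G.degree a ≤ G.degree v :=
    hv ▸ Tuple.le_comp_sort_rev_zero (fun w => G.degree w) h0 a
  rw [hd₁, hv]
  let _ := fun (a b : Fin n) => Classical.dec (a = b)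
  exact G.one_add_degree_le_of_eigenvalues_le
    (Tuple.le_comp_sort_rev_zero (G.posSemidef_lapMatrix ℝ).isHermitian.eigenvalues h0)
    (ha.trans_le hav)
end

section
/- Let G be a simple connected graph on n ≥ 2 vertices with m edges. Then the Kirchhoff index of G satisfies K(G) ≥ n(n−1)²/(2m), with equality if and only if all nonzero Laplacian eigenvalues of G are equal. -/
open Finset

/-- The Laplacian eigenvalues, listed by `lapEigs`, are a rearrangement of Mathlib's
`Matrix.IsHermitian.eigenvalues`. -/
lemma exists_perm_lapEigs {n : ℕ} (G : SimpleGraph (Fin n)) [DecidableRel G.Adj] :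
    ∃ σ : Equiv.Perm (Fin n), ∀ i,
      lapEigs G i = (G.posSemidef_lapMatrix ℝ).isHermitian.eigenvalues (σ i) := by
  classical
  refine ⟨Fin.revPerm.trans
    (Tuple.sort (G.posSemidef_lapMatrix ℝ).isHermitian.eigenvalues), fun i => ?_⟩
  simp only [lapEigs, Function.comp_apply, Equiv.trans_apply, Fin.revPerm_apply]
  congr!

lemma lapEigs_antitone {n : ℕ} (G : SimpleGraph (Fin n)) : Antitone (lapEigs G) :=
  fun _ _ hij => Tuple.monotone_sort _ (Fin.rev_le_rev.mpr hij)

lemma lapEigs_nonneg {n : ℕ} (G : SimpleGraph (Fin n)) (i : Fin n) : 0 ≤ lapEigs G i := by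
  classical
  obtain ⟨σ, hσ⟩ := exists_perm_lapEigs G
  rw [hσ]
  exact (G.posSemidef_lapMatrix ℝ).eigenvalues_nonneg _

/-- The Laplacian eigenvalues sum to twice the number of edges. -/
lemma sum_lapEigs {n : ℕ} (G : SimpleGraph (Fin n)) :
    ∑ i, lapEigs G i = 2 * (G.edgeSet.ncard : ℝ) := by
  classical
  obtain ⟨σ, hσ⟩ := exists_perm_lapEigs G
  have htr := (G.posSemidef_lapMatrix ℝ).isHermitian.trace_eq_sum_eigenvalues
  have hdeg : (G.lapMatrix ℝ).trace = ((∑ v, G.degree v : ℕ) : ℝ) := by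
    simp [Matrix.trace, SimpleGraph.lapMatrix, SimpleGraph.degMatrix]
  rw [G.sum_degrees_eq_twice_card_edges, htr] at hdeg
  simp only [hσ]
  rw [Equiv.sum_comp σ]
  simpa [← SimpleGraph.coe_edgeFinset, Set.ncard_coe_finset] using hdeg

/-- A connected graph has exactly one zero Laplacian eigenvalue. -/
lemma card_lapEigs_eq_zero {n : ℕ} (G : SimpleGraph (Fin n)) (hG : G.Connected) :
    #{i | lapEigs G i = 0} = 1 := by
  classical
  obtain ⟨σ, hσ⟩ := exists_perm_lapEigs G
  have hA := (G.posSemidef_lapMatrix ℝ).isHermitian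
  have hker := G.card_connectedComponent_eq_finrank_ker_toLin'_lapMatrix
  have hone : Fintype.card G.ConnectedComponent = 1 := by
    have := hG.nonempty
    have := hG.preconnected.subsingleton_connectedComponent
    exact Fintype.card_eq_one_iff_nonempty_unique.mpr
      ⟨⟨⟨G.connectedComponentMk (Classical.arbitrary _)⟩, fun _ => Subsingleton.elim _ _⟩⟩
  have hrank := LinearMap.finrank_range_add_finrank_ker (Matrix.toLin' (G.lapMatrix ℝ))
  rw [← hker, hone, Module.finrank_fin_fun] at hrank
  have hcard := hA.rank_eq_card_non_zero_eigs
  rw [Matrix.rank, ← Matrix.toLin'_apply', Fintype.card_subtype] at hcard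
  have hsplit := card_filter_add_card_filter_not (s := (univ : Finset (Fin n)))
    (fun i => hA.eigenvalues i = 0)
  have hbij : #{i | lapEigs G i = 0} = #{i | hA.eigenvalues i = 0} :=
    card_equiv σ fun i => by simp [hσ]
  simp only [card_univ, Fintype.card_fin] at hsplit
  simp only [ne_eq] at hcard
  omega

/-- In a connected graph, `lapEigs G i` vanishes only for the last index. -/
lemma lapEigs_eq_zero_iff {n : ℕ} (G : SimpleGraph (Fin n)) (hG : G.Connected) (i : Fin n) :
    lapEigs G i = 0 ↔ ¬ (i : ℕ) < n - 1 := by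
  obtain ⟨k, hk⟩ := card_eq_one.mp (card_lapEigs_eq_zero G hG)
  have hzero (j : Fin n) : lapEigs G j = 0 ↔ j = k := by
    simpa using congrArg (j ∈ ·) hk
  have hlast (j : Fin n) (hj : k ≤ j) : j = k :=
    (hzero j).mp (le_antisymm ((lapEigs_antitone G hj).trans_eq ((hzero k).mpr rfl))
      (lapEigs_nonneg G j))
  have hk' : (k : ℕ) = n - 1 := by
    have hkn := k.isLt
    have := congrArg Fin.val (hlast ⟨n - 1, by omega⟩ (Fin.le_def.mpr (by simp; omega)))
    simpa using this.symm
  rw [hzero, Fin.ext_iff, hk']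
  have := i.isLt
  omega

/-- The defect in the inequality between arithmetic and harmonic means, as a sum of squares. -/
lemma sum_one_div_sub_sq_card_div_sum {ι : Type*} (s : Finset ι) (x : ι → ℝ)
    (hx : ∀ i ∈ s, x i ≠ 0) (hS : ∑ i ∈ s, x i ≠ 0) :
    ∑ i ∈ s, 1 / x i - (#s : ℝ) ^ 2 / ∑ i ∈ s, x i =
      ∑ i ∈ s, (#s * x i - ∑ j ∈ s, x j) ^ 2 / (x i * (∑ j ∈ s, x j) ^ 2) := by
  generalize hT : ∑ i ∈ s, x i = T at *
  have hterm : ∀ i ∈ s, (#s * x i - T) ^ 2 / (x i * T ^ 2) =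
      (#s : ℝ) ^ 2 / T ^ 2 * x i - 2 * #s / T + 1 / x i := fun i hi => by
    have := hx i hi
    field_simp
    ring
  rw [sum_congr rfl hterm, sum_add_distrib, sum_sub_distrib, ← mul_sum, hT, sum_const,
    nsmul_eq_mul]
  field_simp
  ring

/-- The inequality between arithmetic and harmonic means, with its equality case. -/
lemma sq_card_div_sum_le_sum_one_div {ι : Type*} (s : Finset ι) (x : ι → ℝ)
    (hx : ∀ i ∈ s, 0 < x i) :
    (#s : ℝ) ^ 2 / ∑ i ∈ s, x i ≤ ∑ i ∈ s, 1 / x i ∧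
      (∑ i ∈ s, 1 / x i = (#s : ℝ) ^ 2 / ∑ i ∈ s, x i ↔
        ∀ i ∈ s, ∀ j ∈ s, x i = x j) := by
  rcases s.eq_empty_or_nonempty with rfl | hs
  · simp
  have hS : 0 < ∑ i ∈ s, x i := sum_pos hx hs
  have hcard : (0 : ℝ) < #s := by exact_mod_cast hs.card_pos
  have key := sum_one_div_sub_sq_card_div_sum s x (fun i hi => (hx i hi).ne') hS.ne'
  have hnonneg : ∀ i ∈ s, 0 ≤ (#s * x i - ∑ j ∈ s, x j) ^ 2 / (x i * (∑ j ∈ s, x j) ^ 2) :=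
    fun i hi => by
      have := hx i hi
      positivity
  refine ⟨sub_nonneg.mp (key ▸ sum_nonneg hnonneg), ?_⟩
  rw [← sub_eq_zero, key, sum_eq_zero_iff_of_nonneg hnonneg]
  have hterm : ∀ i ∈ s, ((#s * x i - ∑ j ∈ s, x j) ^ 2 / (x i * (∑ j ∈ s, x j) ^ 2) = 0 ↔
      #s * x i = ∑ j ∈ s, x j) := fun i hi => by
    simp [(hx i hi).ne', hS.ne', sub_eq_zero]
  constructor
  · intro h i hi j hj
    exact mul_left_cancel₀ hcard.ne'
      (((hterm i hi).mp (h i hi)).trans ((hterm j hj).mp (h j hj)).symm)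
  · intro h i hi
    rw [hterm i hi, sum_congr rfl fun j hj => h j hj i hi, sum_const, nsmul_eq_mul]

/-- For a simple connected graph `G` on `n ≥ 2` vertices with `m` edges,
`K(G) ≥ n(n−1)²/(2m)`, with equality iff all nonzero Laplacian eigenvalues of `G` are
equal. -/
theorem kirchhoff_lower_bound_classic {n m : ℕ}
    (hn : 2 ≤ n)
    (G : SimpleGraph (Fin n))
    (hconn : G.Connected)
    (hm : G.edgeSet.ncard = m) :
    (n : ℝ) * ((n : ℝ) - 1) ^ 2 / (2 * (m : ℝ)) ≤ kirchhoffIndex G ∧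
      (kirchhoffIndex G = (n : ℝ) * ((n : ℝ) - 1) ^ 2 / (2 * (m : ℝ)) ↔
        ∀ i j : Fin n, lapEigs G i ≠ 0 → lapEigs G j ≠ 0 → lapEigs G i = lapEigs G j) := by
  set s := univ.filter (fun i : Fin n => (i : ℕ) < n - 1) with hs
  have hn0 : (0 : ℝ) < n := by positivity
  have hpos : ∀ i ∈ s, 0 < lapEigs G i := fun i hi =>
    (lapEigs_nonneg G i).lt_of_ne' fun h =>
      (lapEigs_eq_zero_iff G hconn i).mp h (mem_filter.mp hi).2
  have hcard : (#s : ℝ) = n - 1 := by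
    rw [hs, Fin.card_filter_val_lt, min_eq_right (by omega), Nat.cast_sub (by omega), Nat.cast_one]
  have hsum : ∑ i ∈ s, lapEigs G i = 2 * (m : ℝ) := by
    rw [← hm, ← sum_lapEigs]
    exact sum_subset (subset_univ s) fun i _ hi =>
      (lapEigs_eq_zero_iff G hconn i).mpr (by simpa [hs] using hi)
  obtain ⟨hle, heq⟩ := sq_card_div_sum_le_sum_one_div s (lapEigs G) hpos
  rw [hcard, hsum] at hle heq
  rw [kirchhoffIndex, mul_div_assoc]
  refine ⟨mul_le_mul_of_nonneg_left hle hn0.le, ?_⟩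
  rw [mul_right_inj' hn0.ne', heq]
  have hmem (i : Fin n) : i ∈ s ↔ lapEigs G i ≠ 0 := by
    rw [ne_eq, lapEigs_eq_zero_iff G hconn, not_not, hs, mem_filter, and_iff_right (mem_univ i)]
  simp only [hmem]
  exact ⟨fun h i j hi hj => h i hi j hj, fun h i hi j hj => h i j hi hj⟩
end
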